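/- Let k be a field and let k[x,y] be the polynomial ring in two variables over k. The matrix [[1+xy, y²], [−x², 1−xy]] belongs to GL₂(k[x,y]) (it has determinant 1), but it does not belong to the subgroup E₂(k[x,y]) of GL₂(k[x,y]) generated by all elementary 2×2 matrices. -/

import Mathlib

open Matrix MvPolynomial

/-- The set of elementary 2×2 matrices (as elements of `GL₂ A`):
matrices of the form `E₁₂(a) = [[1,a],[0,1]]` or `E₂₁(a) = [[1,0],[a,1]]`. -/
def elemSet (A : Type*) [CommRing A] : Set (GL (Fin 2) A) :=
  {U | ∃ a : A, (U : Matrix (Fin 2) (Fin 2) A) = !![1, a; 0, 1] ∨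
      (U : Matrix (Fin 2) (Fin 2) A) = !![1, 0; a, 1]}

/-- `E₂(A)`: the subgroup of `GL₂(A)` generated by all elementary 2×2 matrices. -/
def E2 (A : Type*) [CommRing A] : Subgroup (GL (Fin 2) A) :=
  Subgroup.closure (elemSet A)

section Reduction

variable {σ k : Type*} [Field k]

/-- Pairs built from `(c, 0)`, `c` a nonzero constant, by successive steps
`(a, b) ↦ (q * a + b, a)` with `q` nonconstant. -/
inductive EuclideanPair : MvPolynomial σ k → MvPolynomial σ k → Prop
  | base (c : k) (hc : c ≠ 0) : EuclideanPair (C c) 0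
  | step (a b q : MvPolynomial σ k) (h : EuclideanPair a b) (hq : ∀ c, q ≠ C c) :
      EuclideanPair (q * a + b) a

theorem EuclideanPair.totalDegree_lt {a b : MvPolynomial σ k} (h : EuclideanPair a b) :
    a ≠ 0 ∧ (b = 0 ∨ b.totalDegree < a.totalDegree) := by
  induction h with
  | base c hc => exact ⟨by simpa using hc, Or.inl rfl⟩
  | step a b q _ hq ih =>
    obtain ⟨ha, hb⟩ := ih
    have hq0 : q ≠ 0 := by simpa using hq 0
    have hqd : q.totalDegree ≠ 0 := fun h0 => hq _ (totalDegree_eq_zero_iff_eq_C.1 h0)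
    have hmul : (q * a).totalDegree = q.totalDegree + a.totalDegree :=
      totalDegree_mul_of_isDomain hq0 ha
    have hba : b.totalDegree ≤ a.totalDegree := by
      rcases hb with rfl | hb
      · simp
      · exact hb.le
    have hadd : (q * a + b).totalDegree = (q * a).totalDegree :=
      totalDegree_add_eq_left_of_totalDegree_lt (by omega)
    have hlt : a.totalDegree < (q * a + b).totalDegree := by omega
    refine ⟨fun h0 => ?_, Or.inr hlt⟩
    rw [h0] at hlt
    simp at hlt

theorem EuclideanPair.add_C_mul {a b : MvPolynomial σ k} (h : EuclideanPair a b) (c : k) :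
    EuclideanPair (a + C c * b) b := by
  cases h with
  | base d hd => simpa using EuclideanPair.base d hd
  | step a' b' q h hq =>
    have hq' : ∀ d, q + C c ≠ C d := fun d hd =>
      hq (d - c) (by rw [C_sub, ← hd, add_sub_cancel_right])
    convert EuclideanPair.step b b' _ h hq' using 1
    ring

/-- The `GL₂(k)`-saturation of `EuclideanPair`. -/
def IsReducible (v w : MvPolynomial σ k) : Prop :=
  ∃ (α β γ δ : k) (a b : MvPolynomial σ k), α * δ - β * γ ≠ 0 ∧ EuclideanPair a b ∧
    v = C α * a + C β * b ∧ w = C γ * a + C δ * b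

theorem IsReducible.swap {v w : MvPolynomial σ k} (h : IsReducible v w) : IsReducible w v := by
  obtain ⟨α, β, γ, δ, a, b, hD, hab, rfl, rfl⟩ := h
  exact ⟨γ, δ, α, β, a, b, fun h0 => hD (by linear_combination -h0), hab, rfl, rfl⟩

theorem EuclideanPair.isReducible_mul_add {a b : MvPolynomial σ k} (h : EuclideanPair a b)
    (q : MvPolynomial σ k) {ε γ : k} (hε : ε ≠ 0) (hγ : γ ≠ 0) :
    IsReducible (C ε * (q * a + b)) (C γ * a) := by
  by_cases hq : ∀ c, q ≠ C c
  · exact ⟨ε, 0, 0, γ, _, _, by simp [hε, hγ], h.step _ _ q hq, by simp, by simp⟩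
  · push Not at hq
    obtain ⟨c, rfl⟩ := hq
    exact ⟨ε * c, ε, γ, 0, a, b, by simp [hε, hγ], h, by rw [C_mul]; ring, by simp⟩

theorem IsReducible.add_mul_left {v w : MvPolynomial σ k} (h : IsReducible v w)
    (p : MvPolynomial σ k) : IsReducible (v + p * w) w := by
  obtain ⟨α, β, γ, δ, a, b, hD, hab, rfl, rfl⟩ := h
  by_cases hγ : γ = 0
  · subst hγ
    have hα : α ≠ 0 := by rintro rfl; simp at hD
    have hδ : δ ≠ 0 := by rintro rfl; simp at hD
    have hinv : (C α * C α⁻¹ : MvPolynomial σ k) = 1 := by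
      rw [← C_mul, mul_inv_cancel₀ hα, C_1]
    cases hab with
    | base c hc => exact ⟨α, β, 0, δ, _, _, hD, .base c hc, by simp, by simp⟩
    | step _ b' q h hq =>
      convert h.isReducible_mul_add (q + C α⁻¹ * (C β + p * C δ)) hα hδ using 1
      · rw [C_0]
        linear_combination -(C β + p * C δ) * b * hinv
      · simp
  · have hε : β - α * (δ / γ) ≠ 0 := fun h0 => hD (by field_simp at h0; linear_combination -h0)
    have hinv : (C (β - α * (δ / γ)) * C (β - α * (δ / γ))⁻¹ : MvPolynomial σ k) = 1 := by
      rw [← C_mul, mul_inv_cancel₀ hε, C_1]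
    have hδ : (C δ : MvPolynomial σ k) = C γ * C (δ / γ) := by
      rw [← C_mul, mul_div_cancel₀ _ hγ]
    have hβ : (C β : MvPolynomial σ k) = C (β - α * (δ / γ)) + C α * C (δ / γ) := by
      rw [← C_mul, ← C_add, sub_add_cancel]
    convert (hab.add_C_mul (δ / γ)).isReducible_mul_add
      (C (β - α * (δ / γ))⁻¹ * (C α + p * C γ)) hε hγ using 1
    · rw [hδ, hβ]
      linear_combination -(C α + p * C γ) * (a + C (δ / γ) * b) * hinv
    · rw [hδ]
      ring

theorem IsReducible.add_mul_right {v w : MvPolynomial σ k} (h : IsReducible v w)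
    (p : MvPolynomial σ k) : IsReducible v (w + p * v) :=
  (h.swap.add_mul_left p).swap

theorem isReducible_mulVec_iff {U : GL (Fin 2) (MvPolynomial σ k)}
    (hU : U ∈ E2 (MvPolynomial σ k)) (v : Fin 2 → MvPolynomial σ k) :
    IsReducible ((U.val *ᵥ v) 0) ((U.val *ᵥ v) 1) ↔ IsReducible (v 0) (v 1) := by
  induction hU using Subgroup.closure_induction generalizing v with
  | mem U hU =>
    obtain ⟨p, hU | hU⟩ := hU
    · simp only [hU, mulVec, dotProduct, Fin.sum_univ_two, of_apply, cons_val_zero, cons_val_one,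
        one_mul, zero_mul, zero_add]
      exact ⟨fun h => by simpa using h.add_mul_left (-p), fun h => h.add_mul_left p⟩
    · simp only [hU, mulVec, dotProduct, Fin.sum_univ_two, of_apply, cons_val_zero, cons_val_one,
        one_mul, zero_mul, add_zero]
      rw [add_comm (p * v 0)]
      exact ⟨fun h => by simpa using h.add_mul_right (-p), fun h => h.add_mul_right p⟩
  | one => simp
  | mul U V _ _ hU hV => rw [Units.val_mul, ← mulVec_mulVec, hU, hV]
  | inv U _ hU =>
    rw [← hU, mulVec_mulVec, ← Units.val_mul, mul_inv_cancel, Units.val_one, one_mulVec]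

/-- The first column of any matrix in `E₂(k[σ])` is reducible. -/
theorem isReducible_of_mem_E2 {U : GL (Fin 2) (MvPolynomial σ k)}
    (hU : U ∈ E2 (MvPolynomial σ k)) : IsReducible (U.val 0 0) (U.val 1 0) := by
  have h := (isReducible_mulVec_iff hU ![1, 0]).2
    ⟨1, 0, 0, 1, C 1, 0, by simp, .base 1 one_ne_zero, by simp, by simp⟩
  simpa [mulVec, dotProduct, Fin.sum_univ_two] using h

/-- If all nontrivial `k`-combinations of `v` and `w` are nonzero of the same total degree,
then `(v, w)` is not reducible. -/
theorem not_isReducible_of_totalDegree_eq {v w : MvPolynomial σ k} {n : ℕ}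
    (h : ∀ s t : k, (s ≠ 0 ∨ t ≠ 0) →
      C s * v + C t * w ≠ 0 ∧ (C s * v + C t * w).totalDegree = n) :
    ¬ IsReducible v w := by
  rintro ⟨α, β, γ, δ, a, b, hD, hab, rfl, rfl⟩
  set D := α * δ - β * γ with hDdef
  have hinv : (C D⁻¹ * (C α * C δ - C β * C γ) : MvPolynomial σ k) = 1 := by
    rw [← C_mul, ← C_mul, ← C_sub, ← C_mul, inv_mul_cancel₀ hD, C_1]
  have ha := h (D⁻¹ * δ) (-(D⁻¹ * β)) (by
    by_contra! h0
    simp only [mul_eq_zero, neg_eq_zero, inv_eq_zero, hD, false_or] at h0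
    simp [hDdef, h0] at hD)
  have hb := h (-(D⁻¹ * γ)) (D⁻¹ * α) (by
    by_contra! h0
    simp only [mul_eq_zero, neg_eq_zero, inv_eq_zero, hD, false_or] at h0
    simp [hDdef, h0] at hD)
  have hae : C (D⁻¹ * δ) * (C α * a + C β * b) + C (-(D⁻¹ * β)) * (C γ * a + C δ * b) = a := by
    rw [C_neg, C_mul, C_mul]
    linear_combination a * hinv
  have hbe : C (-(D⁻¹ * γ)) * (C α * a + C β * b) + C (D⁻¹ * α) * (C γ * a + C δ * b) = b := by
    rw [C_neg, C_mul, C_mul]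
    linear_combination b * hinv
  rw [hae] at ha
  rw [hbe] at hb
  rcases hab.totalDegree_lt.2 with h0 | h0
  · exact hb.1 h0
  · omega

end Reduction

theorem totalDegree_anick_column_combination {k : Type*} [Field k] (s t : k)
    (hst : s ≠ 0 ∨ t ≠ 0) :
    C s * (1 + X 0 * X 1) + C t * -(X 0) ^ 2 ≠ (0 : MvPolynomial (Fin 2) k) ∧
    (C s * (1 + X 0 * X 1) + C t * -(X 0) ^ 2 : MvPolynomial (Fin 2) k).totalDegree = 2 := by
  have hp : (C s * (1 + X 0 * X 1) + C t * -(X 0) ^ 2 : MvPolynomial (Fin 2) k) =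
      monomial 0 s + monomial (Finsupp.single 0 1 + Finsupp.single 1 1) s
        + monomial (Finsupp.single 0 2) (-t) := by
    have h1 : (monomial (Finsupp.single 0 1 + Finsupp.single 1 1) s : MvPolynomial (Fin 2) k) =
        C s * (X 0 * X 1) := by
      rw [X, X, monomial_mul, C_mul_monomial]; simp
    have h2 : (monomial (Finsupp.single 0 2) (-t) : MvPolynomial (Fin 2) k) =
        C (-t) * X 0 ^ 2 := by
      rw [X_pow_eq_monomial, C_mul_monomial, mul_one]
    rw [h1, h2, ← C_apply, C_neg]
    ring
  rw [hp]
  have e1 : (Finsupp.single 0 1 + Finsupp.single 1 1 : Fin 2 →₀ ℕ) ≠ 0 := fun h => by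
    simpa using DFunLike.congr_fun h 0
  have e2 : (Finsupp.single 0 2 : Fin 2 →₀ ℕ) ≠ 0 := fun h => by
    simpa using DFunLike.congr_fun h 0
  have e3 : (Finsupp.single 0 2 : Fin 2 →₀ ℕ) ≠ Finsupp.single 0 1 + Finsupp.single 1 1 :=
    fun h => by simpa using DFunLike.congr_fun h 1
  set p : MvPolynomial (Fin 2) k := monomial 0 s +
    monomial (Finsupp.single 0 1 + Finsupp.single 1 1) s + monomial (Finsupp.single 0 2) (-t)
    with hpdef
  have c1 : p.coeff (Finsupp.single 0 1 + Finsupp.single 1 1) = s := by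
    simp [hpdef, coeff_add, coeff_monomial, e1.symm, e3]
  have c2 : p.coeff (Finsupp.single 0 2) = -t := by
    simp [hpdef, coeff_add, coeff_monomial, e2.symm, e3.symm]
  have hle : p.totalDegree ≤ 2 := by
    refine (totalDegree_add _ _).trans (max_le ((totalDegree_add _ _).trans (max_le ?_ ?_)) ?_)
    · exact (totalDegree_monomial_le _ _).trans (by simp)
    · exact (totalDegree_monomial_le _ _).trans (by
        rw [Finsupp.sum_add_index'] <;> simp)
    · exact (totalDegree_monomial_le _ _).trans (by simp)
  have hge : 2 ≤ p.totalDegree := by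
    rcases hst with hs | ht
    · have := le_totalDegree (mem_support_iff.2 (c1.trans_ne hs))
      rw [Finsupp.sum_add_index'] at this <;> simp_all
    · have := le_totalDegree (mem_support_iff.2 (c2.trans_ne (neg_ne_zero.2 ht)))
      simpa using this
  exact ⟨fun h0 => by rw [h0] at hge; simp at hge, le_antisymm hle hge⟩

/-- The matrix `[[1+xy, y²], [−x², 1−xy]]` over `k[x,y]` has determinant 1
(hence lies in `GL₂(k[x,y])`), but it does not lie in `E₂(k[x,y])`. -/
theorem anick_matrix_not_in_E2 (k : Type*) [Field k] :
    (!![1 + X 0 * X 1, (X 1) ^ 2; -(X 0) ^ 2, 1 - X 0 * X 1] :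
        Matrix (Fin 2) (Fin 2) (MvPolynomial (Fin 2) k)).det = 1 ∧
    ∀ U : GL (Fin 2) (MvPolynomial (Fin 2) k),
      (U : Matrix (Fin 2) (Fin 2) (MvPolynomial (Fin 2) k)) =
        !![1 + X 0 * X 1, (X 1) ^ 2; -(X 0) ^ 2, 1 - X 0 * X 1] →
      U ∉ E2 (MvPolynomial (Fin 2) k) := by
  refine ⟨by rw [det_fin_two_of]; ring, fun U hU hmem => ?_⟩
  have h := isReducible_of_mem_E2 hmem
  rw [hU] at h
  exact not_isReducible_of_totalDegree_eq totalDegree_anick_column_combination h
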